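/- arXiv:1210.7856 — 2 statements merged into one kernel-verified Lean document; each statement's English description precedes it below -/
import Mathlib

section
/- Let F be a probability distribution supported on (0,∞) with Laplace transform φ, and let λ, a > 0. Then F(x) ∼ λ^a x^a/Γ(a+1) as x → 0 if and only if φ(y) ∼ λ^a/y^a as y → ∞. Moreover, if F(x) ∼ λ^a x^a/Γ(a+1) as x → 0, and for u ∈ (0,1) X_u denotes a random variable with distribution G_u, then u^{−1/a} X_u converges in distribution to gamma(a+1,λ) as u → 0+. -/
open MeasureTheory ProbabilityTheory Real Set Filter Topology Asymptotics
open scoped ENNReal NNReal BigOperators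

/-- The Laplace transform `φ(y) = ∫ e^{-yx} F(dx)` of a distribution `F`. -/
noncomputable def lapl (F : Measure ℝ) (y : ℝ) : ℝ := ∫ x, Real.exp (-(y * x)) ∂F

/-- The distribution `G_u(dx) = x e^{-xφ⁻¹(u)} F(dx) / (-φ'(φ⁻¹(u)))`, where `ψ = φ⁻¹` and
`-φ'(y) = ∫ t e^{-yt} F(dt)`. -/
noncomputable def Gmeas (F : Measure ℝ) (ψ : ℝ → ℝ) (u : ℝ) : Measure ℝ :=
  F.withDensity fun x =>
    ENNReal.ofReal (x * Real.exp (-(ψ u * x)) / ∫ t, t * Real.exp (-(ψ u * t)) ∂F)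

theorem tendsto_of_forall_approx {ι : Type*} {l : Filter ι} {B : ι → ℝ} {b : ℝ}
    (h : ∀ ε > 0, ∃ (A : ι → ℝ) (a : ℝ), Tendsto A l (𝓝 a) ∧ (∀ᶠ i in l, |B i - A i| ≤ ε) ∧
      |b - a| ≤ ε) : Tendsto B l (𝓝 b) := by
  rw [Metric.tendsto_nhds]
  intro ε hε
  obtain ⟨A, a, hA, hB, hb⟩ := h (ε / 4) (by positivity)
  filter_upwards [Metric.tendsto_nhds.1 hA (ε / 4) (by positivity), hB] with i h1 h2
  rw [Real.dist_eq] at *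
  rw [abs_le] at *
  rw [abs_lt] at *
  constructor <;> linarith

theorem integrable_comp_exp_neg {μ : Measure ℝ} [IsFiniteMeasure μ] {c : ℝ}
    (h0 : ∀ᵐ x ∂μ, 0 ≤ c * x) {g : ℝ → ℝ} (hg : Continuous g) :
    Integrable (fun x => g (rexp (-(c * x)))) μ := by
  obtain ⟨C, hC⟩ := (isCompact_Icc (a := (0 : ℝ)) (b := 1)).exists_bound_of_continuousOn
    hg.continuousOn
  refine Integrable.of_bound (by fun_prop) C ?_
  filter_upwards [h0] with x hx
  exact hC _ ⟨(exp_pos _).le, by simpa using hx⟩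

theorem abs_integral_sub_le_of_forall_Icc {μ : Measure ℝ} [IsProbabilityMeasure μ] {c : ℝ}
    (h0 : ∀ᵐ x ∂μ, 0 ≤ c * x) {f g : ℝ → ℝ} (hf : Continuous f) (hg : Continuous g) {ε : ℝ}
    (h : ∀ x ∈ Icc (0 : ℝ) 1, |f x - g x| ≤ ε) :
    |(∫ x, f (rexp (-(c * x))) ∂μ) - ∫ x, g (rexp (-(c * x))) ∂μ| ≤ ε := by
  rw [← integral_sub (integrable_comp_exp_neg h0 hf) (integrable_comp_exp_neg h0 hg)]
  have hb : ∀ᵐ x ∂μ, ‖f (rexp (-(c * x))) - g (rexp (-(c * x)))‖ ≤ ε := by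
    filter_upwards [h0] with x hx
    exact h _ ⟨(exp_pos _).le, by simpa using hx⟩
  simpa using norm_integral_le_of_norm_le_const hb

theorem integral_polynomial_comp_exp_neg {μ : Measure ℝ} [IsFiniteMeasure μ] {c : ℝ}
    (h0 : ∀ᵐ x ∂μ, 0 ≤ c * x) (p : Polynomial ℝ) :
    ∫ x, p.eval (rexp (-(c * x))) ∂μ =
      ∑ k ∈ Finset.range (p.natDegree + 1), p.coeff k * ∫ x, rexp (-(k * (c * x))) ∂μ := by
  simp_rw [Polynomial.eval_eq_sum_range, ← Real.exp_nat_mul, ← integral_const_mul, mul_neg]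
  refine integral_finsetSum _ fun k _ => ?_
  have := integrable_comp_exp_neg h0 (g := fun s => p.coeff k * s ^ k) (by fun_prop)
  simpa only [← Real.exp_nat_mul, mul_neg] using this

theorem tendsto_integral_comp_exp_neg {ι : Type*} {l : Filter ι} {μ : ι → Measure ℝ} {c : ι → ℝ}
    {ν : Measure ℝ} [IsProbabilityMeasure ν] (hμ : ∀ᶠ i in l, IsProbabilityMeasure (μ i))
    (h0 : ∀ᶠ i in l, ∀ᵐ x ∂(μ i), 0 ≤ c i * x) (hν : ∀ᵐ x ∂ν, 0 ≤ x)
    (h : ∀ k : ℕ, Tendsto (fun i => ∫ x, rexp (-(k * (c i * x))) ∂(μ i)) l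
      (𝓝 (∫ x, rexp (-(k * x)) ∂ν))) {g : ℝ → ℝ} (hg : Continuous g) :
    Tendsto (fun i => ∫ x, g (rexp (-(c i * x))) ∂(μ i)) l (𝓝 (∫ x, g (rexp (-x)) ∂ν)) := by
  have hν' : ∀ᵐ x ∂ν, 0 ≤ 1 * x := by simpa using hν
  refine tendsto_of_forall_approx fun ε hε => ?_
  obtain ⟨p, hp⟩ := exists_polynomial_near_of_continuousOn 0 1 g hg.continuousOn ε hε
  have hp' : ∀ x ∈ Icc (0 : ℝ) 1, |g x - p.eval x| ≤ ε := fun x hx => by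
    rw [abs_sub_comm]; exact (hp x hx).le
  refine ⟨fun i => ∫ x, p.eval (rexp (-(c i * x))) ∂(μ i), ∫ x, p.eval (rexp (-x)) ∂ν, ?_, ?_, ?_⟩
  · have := integral_polynomial_comp_exp_neg hν' p
    simp only [one_mul] at this
    rw [this]
    refine (tendsto_finsetSum _ fun k _ => (h k).const_mul (p.coeff k)).congr' ?_
    filter_upwards [hμ, h0] with i hi h0i
    exact (integral_polynomial_comp_exp_neg h0i p).symm
  · filter_upwards [hμ, h0] with i hi h0i
    exact abs_integral_sub_le_of_forall_Icc h0i hg p.continuous hp'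
  · simpa using abs_integral_sub_le_of_forall_Icc hν' hg p.continuous hp'

theorem continuous_bounded_mul_of_eq_zero {f χ : ℝ → ℝ} {M : ℝ} (hf : ContinuousOn f {0}ᶜ)
    (hM : ∀ x, |f x| ≤ M) (hχ : Continuous χ) (hχ0 : χ 0 = 0) :
    Continuous fun x => f x * χ x := by
  rw [continuous_iff_continuousAt]
  intro x
  by_cases hx : x = 0
  · subst hx
    have h1 : Tendsto χ (𝓝 0) (𝓝 0) := by simpa [hχ0] using hχ.tendsto 0
    have h2 : Tendsto (fun x => M * |χ x|) (𝓝 0) (𝓝 0) := by simpa using h1.abs.const_mul M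
    rw [ContinuousAt, hχ0, mul_zero]
    refine squeeze_zero_norm (fun x => ?_) h2
    rw [norm_mul]
    exact mul_le_mul_of_nonneg_right (hM x) (abs_nonneg _)
  · exact (hf.continuousAt (isOpen_compl_singleton.mem_nhds hx)).mul hχ.continuousAt

/-- Convergence of the Laplace transforms at the natural numbers implies weak convergence of
probability measures on `[0, ∞)`. -/
theorem tendsto_integral_of_tendsto_laplace {ι : Type*} {l : Filter ι} {μ : ι → Measure ℝ}
    {c : ι → ℝ} {ν : Measure ℝ} [IsProbabilityMeasure ν]
    (hμ : ∀ᶠ i in l, IsProbabilityMeasure (μ i))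
    (h0 : ∀ᶠ i in l, ∀ᵐ x ∂(μ i), 0 ≤ c i * x) (hν : ∀ᵐ x ∂ν, 0 ≤ x)
    (h : ∀ k : ℕ, Tendsto (fun i => ∫ x, rexp (-(k * (c i * x))) ∂(μ i)) l
      (𝓝 (∫ x, rexp (-(k * x)) ∂ν))) {f : ℝ → ℝ} (hf : Continuous f) {M : ℝ}
    (hM : ∀ x, |f x| ≤ M) :
    Tendsto (fun i => ∫ x, f (c i * x) ∂(μ i)) l (𝓝 (∫ x, f x ∂ν)) := by
  have hν' : ∀ᵐ x ∂ν, 0 ≤ 1 * x := by simpa using hν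
  have hM0 : 0 ≤ M := (abs_nonneg _).trans (hM 0)
  have hsmall : Tendsto (fun n : ℕ => M * ∫ x, (1 - rexp (-x)) ^ n ∂ν) atTop (𝓝 0) := by
    have : Tendsto (fun n : ℕ => ∫ x, (1 - rexp (-x)) ^ n ∂ν) atTop (𝓝 (∫ x, 0 ∂ν)) := by
      refine tendsto_integral_of_dominated_convergence (fun _ => 1) (fun n => by fun_prop)
        (integrable_const _) (fun n => ?_) ?_
      · filter_upwards [hν] with x hx
        have : rexp (-x) ≤ 1 := by simpa using hx
        rw [norm_pow, Real.norm_of_nonneg (by linarith)]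
        exact pow_le_one₀ (by linarith) (by linarith [exp_pos (-x)])
      · filter_upwards [hν] with x hx
        have : rexp (-x) ≤ 1 := by simpa using hx
        exact tendsto_pow_atTop_nhds_zero_of_lt_one (by linarith) (by linarith [exp_pos (-x)])
    simpa using this.const_mul M
  have key : ∀ (n : ℕ) (μ : Measure ℝ) (c : ℝ) [IsProbabilityMeasure μ], (∀ᵐ x ∂μ, 0 ≤ c * x) →
      |(∫ x, f (c * x) ∂μ) -
        ∫ x, (fun s => f (-Real.log s) * (1 - (1 - s) ^ (n + 1))) (rexp (-(c * x))) ∂μ| ≤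
      M * ∫ x, (fun s => (1 - s) ^ (n + 1)) (rexp (-(c * x))) ∂μ := by
    intro n μ c _ hc
    have hi : Integrable (fun x => (fun s => (1 - s) ^ (n + 1)) (rexp (-(c * x)))) μ :=
      integrable_comp_exp_neg hc (g := fun s => (1 - s) ^ (n + 1)) (by fun_prop)
    have hif : Integrable (fun x => f (c * x)) μ :=
      Integrable.of_bound (by fun_prop) M (ae_of_all _ fun x => hM _)
    have hi2 : Integrable (fun x => f (c * x) * (1 - rexp (-(c * x))) ^ (n + 1)) μ :=
      hi.bdd_mul (c := M) hif.1 (ae_of_all _ fun x => hM _)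
    have e : (∫ x, f (c * x) ∂μ) -
        ∫ x, (fun s => f (-Real.log s) * (1 - (1 - s) ^ (n + 1))) (rexp (-(c * x))) ∂μ =
        ∫ x, f (c * x) * (1 - rexp (-(c * x))) ^ (n + 1) ∂μ := by
      simp only [Real.log_exp, neg_neg, mul_sub, mul_one]
      rw [integral_sub hif hi2]
      ring
    rw [e, ← integral_const_mul]
    have hb : ∀ᵐ x ∂μ, ‖f (c * x) * (1 - rexp (-(c * x))) ^ (n + 1)‖ ≤
        M * (1 - rexp (-(c * x))) ^ (n + 1) := by
      filter_upwards [hc] with x hx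
      have : 0 ≤ 1 - rexp (-(c * x)) := by simpa using hx
      rw [norm_mul, norm_pow, Real.norm_of_nonneg this]
      exact mul_le_mul_of_nonneg_right (hM _) (by positivity)
    exact norm_integral_le_of_norm_le (hi.const_mul M) hb
  refine tendsto_of_forall_approx fun ε hε => ?_
  obtain ⟨n, hn⟩ := ((tendsto_add_atTop_iff_nat 1).2 hsmall |>.eventually (gt_mem_nhds hε)).exists
  have hcont : Continuous fun s => f (-Real.log s) * (1 - (1 - s) ^ (n + 1)) := by
    refine continuous_bounded_mul_of_eq_zero (M := M) ?_ (fun x => hM _) (by fun_prop) (by simp)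
    exact hf.comp_continuousOn Real.continuousOn_log.neg
  refine ⟨_, _, tendsto_integral_comp_exp_neg hμ h0 hν h hcont, ?_, ?_⟩
  · have h1 := (tendsto_integral_comp_exp_neg hμ h0 hν h
      (g := fun s => (1 - s) ^ (n + 1)) (by fun_prop)).const_mul M
    filter_upwards [hμ, h0, h1.eventually (gt_mem_nhds hn)] with i hi h0i h1i
    exact (key n (μ i) (c i) h0i).trans h1i.le
  · have := key n ν 1 hν'
    simp only [one_mul] at this ⊢
    exact this.trans hn.le

theorem integral_gammaMeasure {a r : ℝ} (ha : 0 < a) (hr : 0 < r) (g : ℝ → ℝ) :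
    ∫ x, g x ∂(gammaMeasure a r) =
      ∫ x in Ioi 0, r ^ a / Real.Gamma a * x ^ (a - 1) * rexp (-(r * x)) * g x := by
  rw [gammaMeasure, integral_withDensity_eq_integral_toReal_smul
    (show Measurable (gammaPDF a r) from (measurable_gammaPDFReal a r).ennreal_ofReal) (by simp [gammaPDF]),
    ← integral_Ici_eq_integral_Ioi, ← integral_indicator measurableSet_Ici]
  refine integral_congr_ae (ae_of_all _ fun x => ?_)
  by_cases hx : 0 ≤ x
  · simp only [gammaPDF, ENNReal.toReal_ofReal (gammaPDFReal_nonneg ha hr x)]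
    simp [gammaPDFReal, hx]
  · simp [gammaPDF, gammaPDFReal, hx]

theorem ae_nonneg_gammaMeasure (a r : ℝ) : ∀ᵐ x ∂(gammaMeasure a r), 0 ≤ x := by
  rw [ae_iff]
  simp only [not_le]
  change gammaMeasure a r (Iio 0) = 0
  rw [gammaMeasure, withDensity_apply _ measurableSet_Iio, lintegral_gammaPDF_of_nonpos le_rfl]

theorem integral_exp_neg_gammaMeasure {a r : ℝ} (ha : 0 < a) (hr : 0 < r) {s : ℝ} (hs : 0 ≤ s) :
    ∫ x, rexp (-(s * x)) ∂(gammaMeasure a r) = (r / (r + s)) ^ a := by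
  rw [integral_gammaMeasure ha hr]
  have e : ∀ x : ℝ, r ^ a / Real.Gamma a * x ^ (a - 1) * rexp (-(r * x)) * rexp (-(s * x)) =
      r ^ a / Real.Gamma a * (x ^ (a - 1) * rexp (-((r + s) * x))) := fun x => by
    rw [mul_assoc, ← Real.exp_add]; ring_nf
  simp_rw [e]
  have hrs : 0 < r + s := by positivity
  rw [integral_const_mul, integral_rpow_mul_exp_neg_mul_Ioi ha hrs, div_rpow hr.le hrs.le,
    div_rpow zero_le_one hrs.le, one_rpow]
  have := (Gamma_pos_of_pos ha).ne'
  field_simp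

theorem ae_pos_of_measure_Iic_zero {F : Measure ℝ} (hsupp : F (Iic 0) = 0) : ∀ᵐ x ∂F, 0 < x := by
  rw [ae_iff]
  simp only [not_lt]
  exact hsupp

section Laplace

variable {F : Measure ℝ} [IsProbabilityMeasure F]

theorem integrable_exp_neg_mul (hsupp : F (Iic 0) = 0) {y : ℝ} (hy : 0 ≤ y) :
    Integrable (fun x => rexp (-(y * x))) F := by
  refine integrable_comp_exp_neg (g := fun s => s) ?_ continuous_id
  filter_upwards [ae_pos_of_measure_Iic_zero hsupp] with x hx
  positivity

theorem lapl_pos (hsupp : F (Iic 0) = 0) {y : ℝ} (hy : 0 ≤ y) : 0 < lapl F y :=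
  integral_exp_pos (integrable_exp_neg_mul hsupp hy)

theorem lapl_le_of_le (hsupp : F (Iic 0) = 0) {y z : ℝ} (hy : 0 ≤ y) (hyz : y ≤ z) :
    lapl F z ≤ lapl F y := by
  refine integral_mono_ae (integrable_exp_neg_mul hsupp (hy.trans hyz))
    (integrable_exp_neg_mul hsupp hy) ?_
  filter_upwards [ae_pos_of_measure_Iic_zero hsupp] with x hx
  simp only [Real.exp_le_exp, neg_le_neg_iff]
  gcongr

theorem tendsto_rpow_mul_comp_const_mul {g : ℝ → ℝ} {a C b : ℝ} (hb : 0 < b)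
    (h : Tendsto (fun y : ℝ => y ^ a * g y) atTop (𝓝 C)) :
    Tendsto (fun y : ℝ => y ^ a * g (b * y)) atTop (𝓝 (C / b ^ a)) := by
  refine ((h.comp (tendsto_id.const_mul_atTop hb)).div_const (b ^ a)).congr' ?_
  filter_upwards [eventually_gt_atTop 0] with y hy
  have := (rpow_pos_of_pos hb a).ne'
  simp only [Function.comp, id, mul_rpow hb.le hy.le]
  field_simp

theorem tendsto_rpow_mul_integral_exp_neg_mul (hsupp : F (Iic 0) = 0) {a C : ℝ} (ha : 0 < a)
    (hC : 0 < C) (h : Tendsto (fun y : ℝ => y ^ a * lapl F y) atTop (𝓝 C)) {f : ℝ → ℝ}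
    (hf : Continuous f) {M : ℝ} (hM : ∀ x, |f x| ≤ M) :
    Tendsto (fun y : ℝ => y ^ a * ∫ x, rexp (-(y * x)) * f (y * x) ∂F) atTop
      (𝓝 (C * ∫ x, f x ∂(gammaMeasure a 1))) := by
  have := isProbabilityMeasure_gammaMeasure ha one_pos
  have hF := ae_pos_of_measure_Iic_zero hsupp
  have hμ : ∀ᶠ y in atTop, IsProbabilityMeasure (F.tilted fun x => -(y * x)) := by
    filter_upwards [eventually_ge_atTop 0] with y hy
    exact isProbabilityMeasure_tilted (integrable_exp_neg_mul hsupp hy)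
  have h0 : ∀ᶠ y : ℝ in atTop, ∀ᵐ x ∂(F.tilted fun x => -(y * x)), 0 ≤ y * x := by
    filter_upwards [eventually_ge_atTop 0] with y hy
    refine (tilted_absolutelyContinuous F _).ae_le ?_
    filter_upwards [hF] with x hx
    positivity
  have hint : ∀ (y : ℝ) (g : ℝ → ℝ), ∫ x, g x ∂(F.tilted fun x => -(y * x)) =
      (∫ x, rexp (-(y * x)) * g x ∂F) / lapl F y := by
    intro y g
    rw [integral_tilted, ← integral_div]
    refine integral_congr_ae (ae_of_all _ fun x => ?_)
    simp only [smul_eq_mul, lapl]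
    ring
  have hlap : ∀ k : ℕ, Tendsto (fun y : ℝ => ∫ x, rexp (-(k * (y * x)))
      ∂(F.tilted fun x => -(y * x))) atTop
      (𝓝 (∫ x, rexp (-(k * x)) ∂(gammaMeasure a 1))) := by
    intro k
    have hk : (0 : ℝ) < 1 + k := by positivity
    rw [integral_exp_neg_gammaMeasure ha one_pos k.cast_nonneg, div_rpow zero_le_one hk.le,
      one_rpow]
    have := (tendsto_rpow_mul_comp_const_mul hk h).div h hC.ne'
    rw [div_div_cancel_left' hC.ne', ← one_div] at this
    refine this.congr' ?_
    filter_upwards [eventually_gt_atTop 0] with y hy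
    rw [hint, Pi.div_apply, mul_div_mul_left _ _ (rpow_pos_of_pos hy a).ne']
    congr 1
    refine integral_congr_ae (ae_of_all _ fun x => ?_)
    simp only
    rw [← Real.exp_add]
    ring_nf
  have key := h.mul (tendsto_integral_of_tendsto_laplace hμ h0 (ae_nonneg_gammaMeasure a 1)
    hlap hf hM)
  refine key.congr' ?_
  filter_upwards [eventually_gt_atTop 0] with y hy
  have := (lapl_pos hsupp hy.le).ne'
  rw [hint]
  field_simp

/-- Regular variation of `-φ'`. -/
theorem tendsto_rpow_mul_integral_id_mul_exp_neg (hsupp : F (Iic 0) = 0) {a C : ℝ} (ha : 0 < a)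
    (hC : 0 < C) (h : Tendsto (fun y : ℝ => y ^ a * lapl F y) atTop (𝓝 C)) :
    Tendsto (fun y : ℝ => y ^ (a + 1) * ∫ x, x * rexp (-(y * x)) ∂F) atTop (𝓝 (C * a)) := by
  have hf : Continuous fun t : ℝ => max t 0 * rexp (-max t 0) := by fun_prop
  have hM : ∀ t : ℝ, |max t 0 * rexp (-max t 0)| ≤ 1 := by
    intro t
    have h0 : 0 ≤ max t 0 := le_max_right _ _
    rw [abs_of_nonneg (by positivity), Real.exp_neg, ← div_eq_mul_inv, div_le_one (exp_pos _)]
    linarith [Real.add_one_le_exp (max t 0)]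
  have hJ : ∫ x, max x 0 * rexp (-max x 0) ∂(gammaMeasure a 1) = a / 2 ^ (a + 1) := by
    rw [integral_gammaMeasure ha one_pos]
    have e : ∀ x ∈ Ioi (0 : ℝ), 1 ^ a / Real.Gamma a * x ^ (a - 1) * rexp (-(1 * x)) *
        (max x 0 * rexp (-max x 0)) = 1 / Real.Gamma a * (x ^ (a + 1 - 1) * rexp (-(2 * x))) := by
      intro x hx
      have hx' : 0 < x := hx
      rw [max_eq_left hx'.le, one_rpow, show a + 1 - 1 = (a - 1) + 1 by ring,
        rpow_add_one hx'.ne', show -(2 * x) = -(1 * x) + -x by ring, Real.exp_add]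
      ring
    rw [setIntegral_congr_fun measurableSet_Ioi e, integral_const_mul,
      integral_rpow_mul_exp_neg_mul_Ioi (by positivity) two_pos, Real.Gamma_add_one ha.ne',
      div_rpow zero_le_one zero_le_two, one_rpow]
    have := (Gamma_pos_of_pos ha).ne'
    field_simp
  have key := tendsto_rpow_mul_integral_exp_neg_mul hsupp ha hC h hf hM
  rw [hJ] at key
  have key2 : Tendsto (fun y : ℝ => y ^ (a + 1) * ∫ x, x * rexp (-((2 * y) * x)) ∂F) atTop
      (𝓝 (C * (a / 2 ^ (a + 1)))) := by
    refine key.congr' ?_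
    filter_upwards [eventually_gt_atTop 0] with y hy
    rw [rpow_add_one hy.ne', mul_assoc, ← integral_const_mul y]
    congr 1
    refine integral_congr_ae ?_
    filter_upwards [ae_pos_of_measure_Iic_zero hsupp] with x hx
    rw [max_eq_left (by positivity), show -(2 * y * x) = -(y * x) + -(y * x) by ring, Real.exp_add]
    ring
  have h3 := tendsto_rpow_mul_comp_const_mul
    (g := fun y => ∫ x, x * rexp (-((2 * y) * x)) ∂F) (b := 1 / 2) (by norm_num) key2
  have e : ∀ y : ℝ, 2 * (1 / 2 * y) = y := fun y => by ring
  simp only [e] at h3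
  convert h3 using 2
  rw [div_rpow zero_le_one zero_le_two, one_rpow]
  have : (0 : ℝ) < 2 ^ (a + 1) := by positivity
  field_simp

end Laplace

theorem exists_cutoff_exp {b c : ℝ} (hbc : b < c) : ∃ f : ℝ → ℝ, Continuous f ∧
    (∃ M, ∀ t, |f t| ≤ M) ∧ (∀ t, 0 ≤ f t) ∧ (∀ t, rexp (-t) * f t ≤ 1) ∧
    (∀ t, t ≤ b → rexp (-t) * f t = 1) ∧ ∀ t, c < t → f t = 0 := by
  have hcb : 0 < c - b := sub_pos.2 hbc
  refine ⟨fun t => rexp (min t c) * max 0 (min 1 ((c - t) / (c - b))), by fun_prop,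
    ⟨rexp c, fun t => ?_⟩, fun t => by positivity, fun t => ?_, fun t ht => ?_, fun t ht => ?_⟩
  · rw [abs_of_nonneg (by positivity)]
    have h1 : rexp (min t c) ≤ rexp c := Real.exp_le_exp.2 (min_le_right _ _)
    have h2 : max 0 (min 1 ((c - t) / (c - b))) ≤ 1 := max_le zero_le_one (min_le_left _ _)
    simpa using mul_le_mul h1 h2 (le_max_left _ _) (exp_pos c).le
  · rw [← mul_assoc, ← Real.exp_add]
    have h1 : rexp (-t + min t c) ≤ 1 := by
      rw [Real.exp_le_one_iff]
      linarith [min_le_left t c]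
    have h2 : max 0 (min 1 ((c - t) / (c - b))) ≤ 1 := max_le zero_le_one (min_le_left _ _)
    exact mul_le_one₀ h1 (le_max_left _ _) h2
  · have h2 : 1 ≤ (c - t) / (c - b) := by
      rw [le_div_iff₀ hcb]
      linarith
    simp only
    rw [min_eq_left (by linarith : t ≤ c), min_eq_left h2, max_eq_right zero_le_one, mul_one,
      ← Real.exp_add, neg_add_cancel, Real.exp_zero]
  · have h2 : (c - t) / (c - b) ≤ 0 := div_nonpos_of_nonpos_of_nonneg (by linarith) hcb.le
    simp only
    rw [max_eq_left ((min_le_right _ _).trans h2), mul_zero]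

theorem integrableOn_indicator_Iic_rpow {a : ℝ} (ha : 0 < a) (c : ℝ) :
    IntegrableOn (fun t : ℝ => (Iic c).indicator (fun t => t ^ (a - 1)) t) (Ioi 0) := by
  rw [IntegrableOn, integrable_indicator_iff measurableSet_Iic, IntegrableOn,
    Measure.restrict_restrict measurableSet_Iic, Iic_inter_Ioi]
  rcases le_total 0 c with hc | hc
  · exact (intervalIntegrable_iff_integrableOn_Ioc_of_le hc).1
      (intervalIntegral.intervalIntegrable_rpow' (by linarith))
  · simp [Ioc_eq_empty (not_lt.2 hc)]

theorem integral_indicator_Iic_rpow {a : ℝ} (ha : 0 < a) {c : ℝ} (hc : 0 ≤ c) :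
    ∫ t in Ioi (0 : ℝ), (Iic c).indicator (fun t => t ^ (a - 1)) t = c ^ a / a := by
  rw [setIntegral_indicator measurableSet_Iic, Ioi_inter_Iic,
    ← intervalIntegral.integral_of_le hc, integral_rpow (Or.inl (by linarith))]
  simp [zero_rpow ha.ne']

theorem integral_gammaMeasure_one_mem_Icc {a b c : ℝ} (ha : 0 < a) (hb : 0 ≤ b) (hc : 0 ≤ c)
    {f : ℝ → ℝ} (hf : Continuous f) (h0 : ∀ t, 0 ≤ f t) (h1 : ∀ t, rexp (-t) * f t ≤ 1)
    (hfb : ∀ t, t ≤ b → rexp (-t) * f t = 1) (hfc : ∀ t, c < t → f t = 0) :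
    ∫ t, f t ∂(gammaMeasure a 1) ∈
      Icc (b ^ a / Real.Gamma (a + 1)) (c ^ a / Real.Gamma (a + 1)) := by
  have e : ∫ t, f t ∂(gammaMeasure a 1) =
      (∫ t in Ioi 0, t ^ (a - 1) * (rexp (-t) * f t)) / Real.Gamma a := by
    rw [integral_gammaMeasure ha one_pos, ← integral_div]
    congr 1
    ext t
    rw [one_rpow, one_mul]
    ring
  have hG := Gamma_pos_of_pos ha
  have eb : ∀ d : ℝ, d ^ a / Real.Gamma (a + 1) = d ^ a / a / Real.Gamma a := fun d => by
    rw [Real.Gamma_add_one ha.ne', div_div]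
  have hle : ∀ t ∈ Ioi (0 : ℝ), t ^ (a - 1) * (rexp (-t) * f t) ≤
      (Iic c).indicator (fun t => t ^ (a - 1)) t := by
    intro t ht
    have ht' : 0 < t := ht
    by_cases htc : t ≤ c
    · rw [indicator_of_mem (mem_Iic.2 htc)]
      exact mul_le_of_le_one_right (by positivity) (h1 t)
    · simp [htc, hfc t (not_le.1 htc)]
  have hge : ∀ t ∈ Ioi (0 : ℝ), (Iic b).indicator (fun t => t ^ (a - 1)) t ≤
      t ^ (a - 1) * (rexp (-t) * f t) := by
    intro t ht
    have ht' : 0 < t := ht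
    have := h0 t
    by_cases htb : t ≤ b
    · simp [htb, hfb t htb]
    · simp only [mem_Iic, htb, not_false_eq_true, indicator_of_notMem]
      positivity
  have hnn : ∀ t ∈ Ioi (0 : ℝ), 0 ≤ t ^ (a - 1) * (rexp (-t) * f t) := by
    intro t ht
    have ht' : 0 < t := ht
    have := h0 t
    positivity
  have hint : IntegrableOn (fun t => t ^ (a - 1) * (rexp (-t) * f t)) (Ioi 0) := by
    refine (integrableOn_indicator_Iic_rpow ha c).mono' ?_ ?_
    · have : Measurable fun t : ℝ => t ^ (a - 1) := measurable_id.pow_const _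
      exact (this.mul (by fun_prop)).aestronglyMeasurable
    · refine (ae_restrict_iff' measurableSet_Ioi).2 (ae_of_all _ fun t ht => ?_)
      rw [Real.norm_of_nonneg (hnn t ht)]
      exact hle t ht
  rw [e, eb, eb, ← integral_indicator_Iic_rpow ha hb, ← integral_indicator_Iic_rpow ha hc]
  constructor
  · gcongr ?_ / _
    exact setIntegral_mono_on (integrableOn_indicator_Iic_rpow ha b) hint measurableSet_Ioi hge
  · gcongr ?_ / _
    exact setIntegral_mono_on hint (integrableOn_indicator_Iic_rpow ha c) measurableSet_Ioi hle

section Tauberian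

variable {F : Measure ℝ} [IsProbabilityMeasure F]

theorem exists_tendsto_between_measure_Iic (hsupp : F (Iic 0) = 0) {a C : ℝ} (ha : 0 < a)
    (hC : 0 < C) (h : Tendsto (fun y : ℝ => y ^ a * lapl F y) atTop (𝓝 C)) {b c : ℝ}
    (hb : 0 ≤ b) (hbc : b < c) :
    ∃ (A : ℝ → ℝ) (J : ℝ), Tendsto A atTop (𝓝 (C * J)) ∧
      J ∈ Icc (b ^ a / Real.Gamma (a + 1)) (c ^ a / Real.Gamma (a + 1)) ∧
      ∀ y > 0, y ^ a * F.real (Iic (b / y)) ≤ A y ∧ A y ≤ y ^ a * F.real (Iic (c / y)) := by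
  obtain ⟨f, hf, ⟨M, hM⟩, h0, h1, hfb, hfc⟩ := exists_cutoff_exp hbc
  refine ⟨_, _, tendsto_rpow_mul_integral_exp_neg_mul hsupp ha hC h hf hM,
    integral_gammaMeasure_one_mem_Icc ha hb (hb.trans hbc.le) hf h0 h1 hfb hfc, fun y hy => ?_⟩
  have hi : Integrable (fun x => rexp (-(y * x)) * f (y * x)) F := by
    refine Integrable.of_bound (by fun_prop) 1 (ae_of_all _ fun x => ?_)
    have := h0 (y * x)
    rw [Real.norm_of_nonneg (by positivity)]
    exact h1 _
  have hiI : ∀ d : ℝ, Integrable ((Iic (d / y)).indicator fun _ => (1 : ℝ)) F := fun d =>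
    (integrable_const _).indicator measurableSet_Iic
  have eI : ∀ d : ℝ, F.real (Iic (d / y)) = ∫ x, (Iic (d / y)).indicator (fun _ => (1 : ℝ)) x ∂F :=
    fun d => by rw [integral_indicator_const _ measurableSet_Iic]; simp
  constructor
  · rw [eI]
    gcongr y ^ a * ?_
    refine integral_mono (hiI b) hi fun x => ?_
    by_cases hx : x ≤ b / y
    · simp only [mem_Iic, hx, indicator_of_mem]
      rw [hfb _ (by rw [le_div_iff₀ hy] at hx; linarith)]
    · simp only [mem_Iic, hx, not_false_eq_true, indicator_of_notMem]
      have := h0 (y * x)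
      positivity
  · rw [eI]
    gcongr y ^ a * ?_
    refine integral_mono hi (hiI c) fun x => ?_
    by_cases hx : x ≤ c / y
    · simp only [mem_Iic, hx, indicator_of_mem]
      exact h1 _
    · simp only [mem_Iic, hx, not_false_eq_true, indicator_of_notMem]
      rw [hfc _ (by rw [not_le, div_lt_iff₀ hy] at hx; linarith), mul_zero]

/-- Karamata's Tauberian theorem at the origin, with constant slowly varying part. -/
theorem tendsto_measure_Iic_div_rpow (hsupp : F (Iic 0) = 0) {a C : ℝ} (ha : 0 < a)
    (hC : 0 < C) (h : Tendsto (fun y : ℝ => y ^ a * lapl F y) atTop (𝓝 C)) :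
    Tendsto (fun x : ℝ => F.real (Iic x) / x ^ a) (𝓝[>] 0) (𝓝 (C / Real.Gamma (a + 1))) := by
  have hG := Gamma_pos_of_pos (by positivity : 0 < a + 1)
  have hlim : Tendsto (fun c : ℝ => C * (c ^ a / Real.Gamma (a + 1))) (𝓝 1)
      (𝓝 (C / Real.Gamma (a + 1))) := by
    have : ContinuousAt (fun c : ℝ => C * (c ^ a / Real.Gamma (a + 1))) 1 :=
      ((continuousAt_id.rpow_const (Or.inr ha.le)).div_const _).const_mul C
    simpa [ContinuousAt, div_eq_mul_inv] using this
  have main : Tendsto (fun y : ℝ => y ^ a * F.real (Iic (1 / y))) atTop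
      (𝓝 (C / Real.Gamma (a + 1))) := by
    refine tendsto_order.2 ⟨fun m hm => ?_, fun m hm => ?_⟩
    · obtain ⟨b, hbm, hb0, hb1⟩ := (((hlim.mono_left nhdsWithin_le_nhds).eventually
        (lt_mem_nhds hm)).and (Ioo_mem_nhdsLT (zero_lt_one' ℝ))).exists
      obtain ⟨A, J, hA, hJ, hAF⟩ :=
        exists_tendsto_between_measure_Iic hsupp ha hC h hb0.le hb1
      have : m < C * J := hbm.trans_le (mul_le_mul_of_nonneg_left hJ.1 hC.le)
      filter_upwards [hA.eventually (lt_mem_nhds this), eventually_gt_atTop 0] with y h1 hy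
      exact h1.trans_le (hAF y hy).2
    · obtain ⟨c, hcm, hc1⟩ := (((hlim.mono_left nhdsWithin_le_nhds).eventually
        (gt_mem_nhds hm)).and (self_mem_nhdsWithin (s := Ioi 1))).exists
      obtain ⟨A, J, hA, hJ, hAF⟩ :=
        exists_tendsto_between_measure_Iic hsupp ha hC h zero_le_one hc1
      have : C * J < m := (mul_le_mul_of_nonneg_left hJ.2 hC.le).trans_lt hcm
      filter_upwards [hA.eventually (gt_mem_nhds this), eventually_gt_atTop 0] with y h1 hy
      exact (hAF y hy).1.trans_lt h1
  refine (main.comp tendsto_inv_nhdsGT_zero).congr' ?_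
  filter_upwards [self_mem_nhdsWithin] with x hx
  simp only [Function.comp, one_div, inv_inv, inv_rpow (le_of_lt hx)]
  ring

theorem lapl_eq_integral_measure_Iic (hsupp : F (Iic 0) = 0) {y : ℝ} (hy : 0 < y) :
    lapl F y = ∫ t in Ioi 0, rexp (-t) * F.real (Iic (t / y)) := by
  let k : ℝ → ℝ → ℝ := fun x t =>
    {p : ℝ × ℝ | y * p.1 ≤ p.2}.indicator (fun p => rexp (-p.2)) (x, t)
  have hS : MeasurableSet {p : ℝ × ℝ | y * p.1 ≤ p.2} :=
    measurableSet_le (by fun_prop) (by fun_prop)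
  have hk : Integrable (Function.uncurry k) (F.prod (volume.restrict (Ioi 0))) := by
    have h1 : Integrable (fun p : ℝ × ℝ => rexp (-p.2)) (F.prod (volume.restrict (Ioi 0))) := by
      simpa using (integrable_const (1 : ℝ) (μ := F)).mul_prod (integrableOn_exp_neg_Ioi 0)
    exact h1.indicator hS
  have e1 : ∀ x, 0 < x → ∫ t in Ioi 0, k x t = rexp (-(y * x)) := by
    intro x hx
    have hyx : 0 < y * x := by positivity
    have : ∀ t, k x t = (Ici (y * x)).indicator (fun t => rexp (-t)) t := fun t => by
      simp [k, indicator]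
    simp_rw [this]
    rw [setIntegral_indicator measurableSet_Ici, inter_eq_right.2 (Ici_subset_Ioi.2 hyx),
      integral_Ici_eq_integral_Ioi, integral_exp_neg_Ioi]
  have e2 : ∀ t, ∫ x, k x t ∂F = rexp (-t) * F.real (Iic (t / y)) := by
    intro t
    have : ∀ x, k x t = (Iic (t / y)).indicator (fun _ => rexp (-t)) x := fun x => by
      simp [k, indicator, le_div_iff₀' hy]
    simp_rw [this]
    rw [integral_indicator_const _ measurableSet_Iic, smul_eq_mul, mul_comm]
  simp_rw [← e2]
  rw [← integral_integral_swap hk, lapl]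
  refine integral_congr_ae ?_
  filter_upwards [ae_pos_of_measure_Iic_zero hsupp] with x hx
  exact (e1 x hx).symm

/-- The Abelian counterpart of `tendsto_measure_Iic_div_rpow`. -/
theorem tendsto_rpow_mul_lapl (hsupp : F (Iic 0) = 0) {a K : ℝ} (ha : 0 < a)
    (h : Tendsto (fun x : ℝ => F.real (Iic x) / x ^ a) (𝓝[>] 0) (𝓝 K)) :
    Tendsto (fun y : ℝ => y ^ a * lapl F y) atTop (𝓝 (K * Real.Gamma (a + 1))) := by
  obtain ⟨B, hB⟩ : ∃ B, ∀ x > 0, F.real (Iic x) ≤ B * x ^ a := by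
    obtain ⟨δ, hδ, hb⟩ := mem_nhdsGT_iff_exists_Ioo_subset.1
      (h.eventually (gt_mem_nhds (lt_add_one K)))
    have hδ' : 0 < δ := hδ
    refine ⟨max (K + 1) (δ ^ a)⁻¹, fun x hx => ?_⟩
    have hxa := rpow_pos_of_pos hx a
    rcases lt_or_ge x δ with hxδ | hxδ
    · have : F.real (Iic x) / x ^ a < K + 1 := hb ⟨hx, hxδ⟩
      rw [div_lt_iff₀ hxa] at this
      exact this.le.trans (mul_le_mul_of_nonneg_right (le_max_left _ _) hxa.le)
    · have h2 : δ ^ a ≤ x ^ a := rpow_le_rpow hδ'.le hxδ ha.le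
      have h3 : 1 ≤ (δ ^ a)⁻¹ * x ^ a := by
        rw [inv_mul_eq_div, one_le_div (rpow_pos_of_pos hδ' a)]
        exact h2
      exact measureReal_le_one.trans
        (h3.trans (mul_le_mul_of_nonneg_right (le_max_right _ _) hxa.le))
  have hGi : IntegrableOn (fun t : ℝ => rexp (-t) * t ^ a) (Ioi 0) := by
    simpa using Real.GammaIntegral_convergent (by positivity : 0 < a + 1)
  have hG : K * Real.Gamma (a + 1) = ∫ t in Ioi (0 : ℝ), K * (rexp (-t) * t ^ a) := by
    rw [integral_const_mul, Real.Gamma_eq_integral (by positivity)]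
    simp
  have key : Tendsto (fun y : ℝ => ∫ t in Ioi 0, y ^ a * (rexp (-t) * F.real (Iic (t / y)))) atTop
      (𝓝 (∫ t in Ioi (0 : ℝ), K * (rexp (-t) * t ^ a))) := by
    refine tendsto_integral_filter_of_dominated_convergence
      (fun t => B * (rexp (-t) * t ^ a)) ?_ ?_ (hGi.const_mul B) ?_
    · filter_upwards [eventually_gt_atTop 0] with y hy
      have hm : Monotone fun t => F.real (Iic (t / y)) := fun s t hst =>
        measureReal_mono (Iic_subset_Iic.2 (by gcongr))
      have he : Measurable fun t : ℝ => rexp (-t) := by fun_prop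
      exact ((he.mul hm.measurable).const_mul _).aestronglyMeasurable
    · filter_upwards [eventually_gt_atTop 0] with y hy
      refine (ae_restrict_iff' measurableSet_Ioi).2 (ae_of_all _ fun t ht => ?_)
      have ht' : 0 < t := ht
      have h1 := hB (t / y) (by positivity)
      rw [div_rpow ht'.le hy.le] at h1
      have hya := rpow_pos_of_pos hy a
      rw [Real.norm_of_nonneg (by positivity)]
      calc y ^ a * (rexp (-t) * F.real (Iic (t / y)))
          ≤ y ^ a * (rexp (-t) * (B * (t ^ a / y ^ a))) := by gcongr
        _ = B * (rexp (-t) * t ^ a) := by field_simp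
    · refine (ae_restrict_iff' measurableSet_Ioi).2 (ae_of_all _ fun t ht => ?_)
      have ht' : 0 < t := ht
      have h1 : Tendsto (fun y : ℝ => t / y) atTop (𝓝[>] 0) :=
        tendsto_nhdsWithin_iff.2 ⟨tendsto_const_nhds.div_atTop tendsto_id, by
          filter_upwards [eventually_gt_atTop 0] with y hy
          exact div_pos ht' hy⟩
      refine ((h.comp h1).mul_const (rexp (-t) * t ^ a)).congr' ?_
      filter_upwards [eventually_gt_atTop 0] with y hy
      have hya := rpow_pos_of_pos hy a
      have hta := rpow_pos_of_pos ht' a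
      simp only [Function.comp, div_rpow ht'.le hy.le]
      field_simp
  rw [hG]
  refine key.congr' ?_
  filter_upwards [eventually_gt_atTop 0] with y hy
  rw [integral_const_mul, lapl_eq_integral_measure_Iic hsupp hy]

end Tauberian

theorem isEquivalent_const_mul_iff_tendsto_div {α : Type*} {l : Filter α} {u w : α → ℝ} {K : ℝ}
    (hK : K ≠ 0) (hw : ∀ᶠ x in l, w x ≠ 0) :
    (u ~[l] fun x => K * w x) ↔ Tendsto (fun x => u x / w x) l (𝓝 K) := by
  rw [isEquivalent_iff_tendsto_one (hw.mono fun x hx => mul_ne_zero hK hx)]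
  constructor
  · intro h
    have := h.const_mul K
    rw [mul_one] at this
    refine this.congr' (hw.mono fun x hx => ?_)
    simp only [Pi.div_apply]
    field_simp
  · intro h
    have := h.div_const K
    rw [div_self hK] at this
    refine this.congr' (hw.mono fun x hx => ?_)
    simp only [Pi.div_apply]
    field_simp

section Gmeas

variable {F : Measure ℝ} {ψ : ℝ → ℝ} {u : ℝ}

theorem integral_Gmeas (hsupp : F (Iic 0) = 0) (hD : 0 < ∫ t, t * rexp (-(ψ u * t)) ∂F)
    (g : ℝ → ℝ) :
    ∫ x, g x ∂(Gmeas F ψ u) =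
      (∫ x, x * rexp (-(ψ u * x)) * g x ∂F) / ∫ t, t * rexp (-(ψ u * t)) ∂F := by
  rw [Gmeas, integral_withDensity_eq_integral_toReal_smul (by fun_prop) (by simp), ← integral_div]
  refine integral_congr_ae ?_
  filter_upwards [ae_pos_of_measure_Iic_zero hsupp] with x hx
  rw [ENNReal.toReal_ofReal (by positivity), smul_eq_mul]
  ring

theorem isProbabilityMeasure_Gmeas (hsupp : F (Iic 0) = 0)
    (hD : 0 < ∫ t, t * rexp (-(ψ u * t)) ∂F) : IsProbabilityMeasure (Gmeas F ψ u) := by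
  constructor
  have hi : Integrable (fun t => t * rexp (-(ψ u * t))) F := by
    by_contra hi
    rw [integral_undef hi] at hD
    exact hD.false
  rw [Gmeas, withDensity_apply _ MeasurableSet.univ, Measure.restrict_univ,
    ← ofReal_integral_eq_lintegral_ofReal (hi.div_const _), integral_div, div_self hD.ne',
    ENNReal.ofReal_one]
  filter_upwards [ae_pos_of_measure_Iic_zero hsupp] with x hx
  simp only [Pi.zero_apply]
  positivity

theorem tendsto_inverse_lapl_atTop [IsProbabilityMeasure F] (hsupp : F (Iic 0) = 0)
    (hψ : ∀ u ∈ Ioo (0 : ℝ) 1, 0 < ψ u ∧ lapl F (ψ u) = u) : Tendsto ψ (𝓝[>] 0) atTop := by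
  refine tendsto_atTop.2 fun M => ?_
  have hM := lapl_pos hsupp (le_max_right M 0)
  filter_upwards [Ioo_mem_nhdsGT (lt_min hM one_pos)] with u hu
  obtain ⟨h1, h2⟩ := hψ u ⟨hu.1, hu.2.trans_le (min_le_right _ _)⟩
  by_contra! hlt
  have := lapl_le_of_le hsupp h1.le (hlt.le.trans (le_max_left M 0))
  rw [h2] at this
  exact (hu.2.trans_le (min_le_left _ _)).not_ge this

theorem tendsto_integral_Gmeas [IsProbabilityMeasure F] (hsupp : F (Iic 0) = 0) {lam a : ℝ}
    (hlam : 0 < lam) (ha : 0 < a) (hψ : ∀ u ∈ Ioo (0 : ℝ) 1, 0 < ψ u ∧ lapl F (ψ u) = u)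
    (h : Tendsto (fun y : ℝ => y ^ a * lapl F y) atTop (𝓝 (lam ^ a)))
    (f : BoundedContinuousFunction ℝ ℝ) :
    Tendsto (fun u : ℝ => ∫ x, f (u ^ (-(1 / a)) * x) ∂(Gmeas F ψ u)) (𝓝[>] (0 : ℝ))
      (𝓝 (∫ x, f x ∂(gammaMeasure (a + 1) lam))) := by
  have ha1 : 0 < a + 1 := by positivity
  have hC : 0 < lam ^ a := rpow_pos_of_pos hlam a
  have := isProbabilityMeasure_gammaMeasure ha1 hlam
  have hψtop := tendsto_inverse_lapl_atTop hsupp hψ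
  have hφ' := tendsto_rpow_mul_integral_id_mul_exp_neg hsupp ha hC h
  have hCa : 0 < lam ^ a * a := by positivity
  have hDpos : ∀ᶠ y : ℝ in atTop, 0 < ∫ x, x * rexp (-(y * x)) ∂F := by
    filter_upwards [hφ'.eventually (lt_mem_nhds hCa), eventually_gt_atTop 0] with y h1 hy
    exact pos_of_mul_pos_right h1 (by positivity)
  have hDψ := hψtop.eventually hDpos
  have hψpos := hψtop.eventually (eventually_gt_atTop 0)
  have hupos : ∀ᶠ u : ℝ in 𝓝[>] 0, u ∈ Ioo (0 : ℝ) 1 := Ioo_mem_nhdsGT one_pos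
  have hratio : Tendsto (fun u => ψ u / u ^ (-(1 / a))) (𝓝[>] 0) (𝓝 lam) := by
    have h1 : Tendsto (fun u => (ψ u ^ a * lapl F (ψ u)) ^ (1 / a)) (𝓝[>] 0)
        (𝓝 ((lam ^ a) ^ (1 / a))) := (h.comp hψtop).rpow_const (Or.inl hC.ne')
    rw [← rpow_mul hlam.le, mul_one_div_cancel ha.ne', rpow_one] at h1
    refine h1.congr' ?_
    filter_upwards [hupos] with u hu
    obtain ⟨h2, h3⟩ := hψ u hu
    rw [h3, mul_rpow (by positivity) hu.1.le, ← rpow_mul h2.le, mul_one_div_cancel ha.ne',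
      rpow_one, rpow_neg hu.1.le, div_inv_eq_mul]
  refine tendsto_integral_of_tendsto_laplace
    (hDψ.mono fun u hu => isProbabilityMeasure_Gmeas hsupp hu) ?_
    (ae_nonneg_gammaMeasure _ _) (fun k => ?_) f.continuous f.norm_coe_le_norm
  · filter_upwards [hupos] with u hu
    refine (withDensity_absolutelyContinuous F _).ae_le ?_
    filter_upwards [ae_pos_of_measure_Iic_zero hsupp] with x hx
    have := rpow_pos_of_pos hu.1 (-(1 / a))
    positivity
  · rw [integral_exp_neg_gammaMeasure ha1 hlam k.cast_nonneg]
    have hz : Tendsto (fun u => ψ u + k * u ^ (-(1 / a))) (𝓝[>] 0) atTop := by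
      refine tendsto_atTop_mono' _ ?_ hψtop
      filter_upwards [hupos] with u hu
      have := rpow_pos_of_pos hu.1 (-(1 / a))
      have : 0 ≤ k * u ^ (-(1 / a)) := by positivity
      linarith
    have h1 := (hφ'.comp hz).div (hφ'.comp hψtop) hCa.ne'
    rw [div_self hCa.ne'] at h1
    have hlk : lam + k ≠ 0 := by positivity
    have h2 := ((hratio.div (hratio.add_const (k : ℝ)) hlk).rpow_const (p := a + 1)
      (Or.inr ha1.le)).mul h1
    rw [mul_one] at h2
    refine h2.congr' ?_
    filter_upwards [hupos, hψpos, hDψ] with u hu hψu hDu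
    have hc := rpow_pos_of_pos hu.1 (-(1 / a))
    simp only [Pi.div_apply, Function.comp]
    set c := u ^ (-(1 / a))
    have hzu : 0 < ψ u + k * c := by positivity
    have e : ψ u / c / (ψ u / c + k) = ψ u / (ψ u + k * c) := by field_simp
    have hp1 := rpow_pos_of_pos hψu (a + 1)
    have hp2 := rpow_pos_of_pos hzu (a + 1)
    rw [integral_Gmeas hsupp hDu, e, div_rpow hψu.le hzu.le]
    have e2 : ∫ x, x * rexp (-(ψ u * x)) * rexp (-(k * (c * x))) ∂F =
        ∫ x, x * rexp (-((ψ u + k * c) * x)) ∂F := by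
      congr 1
      ext x
      rw [mul_assoc, ← Real.exp_add]
      ring_nf
    rw [e2]
    field_simp

end Gmeas

/-- `F(x) ∼ λᵃxᵃ/Γ(a+1)` as `x → 0⁺` iff `φ(y) ∼ λᵃ/yᵃ` as `y → ∞`; and in
that case, if `X_u ~ G_u`, then `u^{-1/a} X_u` converges in distribution to `gamma(a+1,λ)` as
`u → 0⁺` (convergence tested against bounded continuous functions). -/
theorem cdf_asymp_iff_laplace_asymp_and_Gu_convergence
    (F : Measure ℝ) [IsProbabilityMeasure F] (hsupp : F (Iic 0) = 0)
    (lam a : ℝ) (hlam : 0 < lam) (ha : 0 < a)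
    (ψ : ℝ → ℝ) (hψ : ∀ u ∈ Ioo (0:ℝ) 1, 0 < ψ u ∧ lapl F (ψ u) = u) :
    (((fun x => (F (Iic x)).toReal)
        ~[𝓝[>] (0:ℝ)] fun x => lam ^ a * x ^ a / Real.Gamma (a + 1)) ↔
      (lapl F ~[atTop] fun y => lam ^ a / y ^ a)) ∧
    (((fun x => (F (Iic x)).toReal)
        ~[𝓝[>] (0:ℝ)] fun x => lam ^ a * x ^ a / Real.Gamma (a + 1)) →
      ∀ f : BoundedContinuousFunction ℝ ℝ,
        Tendsto (fun u : ℝ => ∫ x, f (u ^ (-(1/a)) * x) ∂(Gmeas F ψ u)) (𝓝[>] (0:ℝ))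
          (𝓝 (∫ x, f x ∂(gammaMeasure (a + 1) lam)))) := by
  have hC : 0 < lam ^ a := rpow_pos_of_pos hlam a
  have hG := Gamma_pos_of_pos (by positivity : 0 < a + 1)
  have h1 : ((fun x => (F (Iic x)).toReal)
      ~[𝓝[>] (0 : ℝ)] fun x => lam ^ a * x ^ a / Real.Gamma (a + 1)) ↔
      Tendsto (fun x : ℝ => F.real (Iic x) / x ^ a) (𝓝[>] 0)
        (𝓝 (lam ^ a / Real.Gamma (a + 1))) := by
    rw [← isEquivalent_const_mul_iff_tendsto_div (by positivity)]
    · simp only [div_mul_eq_mul_div, measureReal_def]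
    · filter_upwards [self_mem_nhdsWithin] with x hx
      exact (rpow_pos_of_pos hx a).ne'
  have h2 : (lapl F ~[atTop] fun y => lam ^ a / y ^ a) ↔
      Tendsto (fun y : ℝ => y ^ a * lapl F y) atTop (𝓝 (lam ^ a)) := by
    simp only [div_eq_mul_inv]
    rw [isEquivalent_const_mul_iff_tendsto_div hC.ne']
    · simp only [div_inv_eq_mul, mul_comm]
    · filter_upwards [eventually_gt_atTop 0] with y hy
      exact (inv_pos.2 (rpow_pos_of_pos hy a)).ne'
  have h3 : Tendsto (fun x : ℝ => F.real (Iic x) / x ^ a) (𝓝[>] 0)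
      (𝓝 (lam ^ a / Real.Gamma (a + 1))) →
      Tendsto (fun y : ℝ => y ^ a * lapl F y) atTop (𝓝 (lam ^ a)) := fun h => by
    simpa [div_mul_cancel₀ _ hG.ne'] using tendsto_rpow_mul_lapl hsupp ha h
  rw [h1, h2]
  exact ⟨⟨h3, tendsto_measure_Iic_div_rpow hsupp ha hC⟩,
    fun h => tendsto_integral_Gmeas hsupp hlam ha hψ (h3 h)⟩
end

section
/- Let F be a probability distribution supported on (0,∞) with Laplace transform φ, and let λ, a > 0. Suppose φ(y) ∼ λ^a/y^a as y → ∞. For u ∈ (0,1), let X'_u denote a random variable with distribution F_u(dx) = u^{−1} e^{−xφ^{−1}(u)} F(dx). Then u^{−1/a} X'_u converges in distribution to gamma(a,λ) as u → 0+. -/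
open MeasureTheory ProbabilityTheory Real Set Filter Topology Asymptotics
open scoped ENNReal NNReal BigOperators

/-- The distribution `F_u(dx) = u⁻¹ e^{-xφ⁻¹(u)} F(dx)`, where `ψ = φ⁻¹`. -/
noncomputable def Fumeas (F : Measure ℝ) (ψ : ℝ → ℝ) (u : ℝ) : Measure ℝ :=
  F.withDensity fun x => ENNReal.ofReal (u⁻¹ * Real.exp (-(ψ u * x)))

lemma exists_polynomial_exp_neg_near (f : BoundedContinuousFunction ℝ ℝ) (k : ℕ)
    {ε : ℝ} (hε : 0 < ε) :
    ∃ p : Polynomial ℝ, ∀ x, 0 ≤ x →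
      |f x - p.eval (exp (-x))| ≤ ε + ‖f‖ * (1 - exp (-x)) ^ k := by
  have hc : ContinuousOn (fun t : ℝ => f (-log t) * (1 - (1 - t) ^ k)) (Icc 0 1) := by
    intro t _
    apply ContinuousAt.continuousWithinAt
    rcases eq_or_ne t 0 with rfl | ht
    · have h0 : Tendsto (fun t : ℝ => 1 - (1 - t) ^ k) (𝓝 0) (𝓝 0) := by
        have : Continuous (fun t : ℝ => 1 - (1 - t) ^ k) := by fun_prop
        simpa using this.tendsto 0
      have := bdd_le_mul_tendsto_zero' (f := fun t : ℝ => f (-log t)) ‖f‖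
        (Eventually.of_forall fun t => f.norm_coe_le_norm _) h0
      simpa [ContinuousAt] using this
    · have hl : ContinuousAt (fun t : ℝ => f (-log t)) t :=
        f.continuous.continuousAt.comp (Real.continuousAt_log ht).neg
      exact hl.mul (by fun_prop)
  obtain ⟨p, hp⟩ := exists_polynomial_near_of_continuousOn 0 1 _ hc ε hε
  refine ⟨p, fun x hx => ?_⟩
  have he : exp (-x) ≤ 1 := exp_le_one_iff.2 (by linarith)
  have h1 := hp (exp (-x)) ⟨(exp_pos _).le, he⟩
  simp only [log_exp, neg_neg] at h1
  have h2 : |f x * (1 - exp (-x)) ^ k| ≤ ‖f‖ * (1 - exp (-x)) ^ k := by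
    rw [abs_mul, abs_of_nonneg (pow_nonneg (sub_nonneg.2 he) k)]
    exact mul_le_mul_of_nonneg_right (f.norm_coe_le_norm x) (pow_nonneg (sub_nonneg.2 he) k)
  rw [abs_lt] at h1
  rw [abs_le] at h2 ⊢
  constructor <;> nlinarith

lemma integrable_comp_exp_neg_s15 {μ : Measure ℝ} [IsFiniteMeasure μ] (hμ : ∀ᵐ x ∂μ, 0 ≤ x)
    (p : Polynomial ℝ) : Integrable (fun x => p.eval (exp (-x))) μ := by
  obtain ⟨C, hC⟩ := (isCompact_Icc (a := (0 : ℝ)) (b := 1)).exists_bound_of_continuousOn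
    p.continuous.continuousOn
  refine Integrable.of_bound (C := C) (by fun_prop) ?_
  filter_upwards [hμ] with x hx
  exact hC _ ⟨(exp_pos _).le, exp_le_one_iff.2 (by linarith)⟩

lemma integral_polynomial_exp_neg {μ : Measure ℝ} [IsFiniteMeasure μ] (hμ : ∀ᵐ x ∂μ, 0 ≤ x)
    (p : Polynomial ℝ) :
    ∫ x, p.eval (exp (-x)) ∂μ
      = ∑ n ∈ Finset.range (p.natDegree + 1), p.coeff n * lapl μ n := by
  have h (n : ℕ) (x : ℝ) : exp (-x) ^ n = exp (-(n * x)) := by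
    rw [← Real.exp_nat_mul]; ring_nf
  simp only [Polynomial.eval_eq_sum_range]
  rw [integral_finsetSum]
  · simp only [integral_const_mul, h, lapl]
  · intro n _
    have := integrable_comp_exp_neg_s15 hμ (Polynomial.X ^ n)
    simp only [Polynomial.eval_pow, Polynomial.eval_X] at this
    exact this.const_mul _

lemma abs_integral_sub_le {μ : Measure ℝ} [IsProbabilityMeasure μ] (hμ : ∀ᵐ x ∂μ, 0 ≤ x)
    (f : BoundedContinuousFunction ℝ ℝ) {p q : Polynomial ℝ}
    (h : ∀ x, 0 ≤ x → |f x - p.eval (exp (-x))| ≤ q.eval (exp (-x))) :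
    |∫ x, f x ∂μ - ∫ x, p.eval (exp (-x)) ∂μ| ≤ ∫ x, q.eval (exp (-x)) ∂μ := by
  rw [← integral_sub (f.integrable μ) (integrable_comp_exp_neg_s15 hμ p),
    ← Real.norm_eq_abs]
  refine norm_integral_le_of_norm_le (integrable_comp_exp_neg_s15 hμ q) ?_
  filter_upwards [hμ] with x hx using h x hx

lemma tendsto_integral_one_sub_exp_neg_pow {μ : Measure ℝ} [IsProbabilityMeasure μ]
    (hμ : ∀ᵐ x ∂μ, 0 ≤ x) :
    Tendsto (fun k : ℕ => ∫ x, (1 - exp (-x)) ^ k ∂μ) atTop (𝓝 0) := by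
  have := tendsto_integral_of_dominated_convergence (μ := μ)
    (F := fun (k : ℕ) x => (1 - exp (-x)) ^ k) (f := fun _ => (0 : ℝ)) (fun _ => 1)
    (fun k => by fun_prop) (integrable_const _) ?_ ?_
  · simpa using this
  · intro k
    filter_upwards [hμ] with x hx
    have he : exp (-x) ≤ 1 := exp_le_one_iff.2 (by linarith)
    rw [norm_pow, Real.norm_of_nonneg (by linarith)]
    exact pow_le_one₀ (by linarith) (by linarith [exp_pos (-x)])
  · filter_upwards [hμ] with x hx
    have he : exp (-x) ≤ 1 := exp_le_one_iff.2 (by linarith)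
    exact tendsto_pow_atTop_nhds_zero_of_lt_one (by linarith) (by linarith [exp_pos (-x)])

/-- Continuity theorem for Laplace transforms. -/
theorem tendsto_integral_of_tendsto_lapl {ι : Type*} {l : Filter ι} {μ : ι → Measure ℝ}
    {ν : Measure ℝ} [IsProbabilityMeasure ν] (hν : ∀ᵐ x ∂ν, 0 ≤ x)
    (hμ : ∀ᶠ i in l, IsProbabilityMeasure (μ i) ∧ ∀ᵐ x ∂(μ i), 0 ≤ x)
    (hlim : ∀ n : ℕ, Tendsto (fun i => lapl (μ i) n) l (𝓝 (lapl ν n)))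
    (f : BoundedContinuousFunction ℝ ℝ) :
    Tendsto (fun i => ∫ x, f x ∂(μ i)) l (𝓝 (∫ x, f x ∂ν)) := by
  have hpoly (p : Polynomial ℝ) : Tendsto (fun i => ∫ x, p.eval (exp (-x)) ∂(μ i)) l
      (𝓝 (∫ x, p.eval (exp (-x)) ∂ν)) := by
    rw [integral_polynomial_exp_neg hν]
    refine (tendsto_finsetSum _ fun n _ => (hlim n).const_mul (p.coeff n)).congr' ?_
    filter_upwards [hμ] with i ⟨_, hi⟩
    exact (integral_polynomial_exp_neg hi p).symm
  rw [Metric.tendsto_nhds]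
  intro ε hε
  have hk : Tendsto (fun k : ℕ => ‖f‖ * ∫ x, (1 - exp (-x)) ^ k ∂ν) atTop (𝓝 0) := by
    simpa using (tendsto_integral_one_sub_exp_neg_pow hν).const_mul ‖f‖
  obtain ⟨k, hkε⟩ := (hk.eventually_lt_const (show 0 < ε / 8 by positivity)).exists
  obtain ⟨p, hp⟩ := exists_polynomial_exp_neg_near f k (show 0 < ε / 8 by positivity)
  let q : Polynomial ℝ :=
    Polynomial.C (ε / 8) + Polynomial.C ‖f‖ * (1 - Polynomial.X) ^ k
  have hq (x : ℝ) : q.eval (exp (-x)) = ε / 8 + ‖f‖ * (1 - exp (-x)) ^ k := by simp [q]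
  have hpq (x : ℝ) (hx : 0 ≤ x) : |f x - p.eval (exp (-x))| ≤ q.eval (exp (-x)) := by
    rw [hq]; exact hp x hx
  have hqν : ∫ x, q.eval (exp (-x)) ∂ν < ε / 4 := by
    have hint := integrable_comp_exp_neg_s15 hν ((1 - Polynomial.X) ^ k)
    simp only [Polynomial.eval_pow, Polynomial.eval_sub, Polynomial.eval_one,
      Polynomial.eval_X] at hint
    simp only [hq]
    rw [integral_add (integrable_const _) (hint.const_mul _), integral_const_mul]
    simp only [integral_const, probReal_univ, one_smul]
    linarith
  have hνf := abs_integral_sub_le hν f hpq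
  filter_upwards [hμ, (hpoly q).eventually_lt_const hqν,
    Metric.tendsto_nhds.1 (hpoly p) (ε / 4) (by positivity)] with i ⟨_, hi⟩ hqi hpi
  have hif := abs_integral_sub_le hi f hpq
  rw [Real.dist_eq] at hpi ⊢
  rw [abs_le] at hif hνf
  rw [abs_lt] at hpi ⊢
  constructor <;> linarith

lemma ae_gammaMeasure_nonneg {a r : ℝ} : ∀ᵐ x ∂(gammaMeasure a r), 0 ≤ x := by
  simp only [gammaMeasure, ae_iff, not_le]
  exact (withDensity_apply _ measurableSet_Iio).trans (lintegral_gammaPDF_of_nonpos le_rfl)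

lemma lapl_gammaMeasure {a r s : ℝ} (ha : 0 < a) (hr : 0 < r) (hs : 0 ≤ s) :
    lapl (gammaMeasure a r) s = r ^ a / (r + s) ^ a := by
  have hrs : 0 < r + s := by linarith
  have hG := (Real.Gamma_pos_of_pos ha).ne'
  rw [lapl, gammaMeasure, integral_withDensity_eq_integral_toReal_smul
    (by exact (measurable_gammaPDFReal a r).ennreal_ofReal) (by simp [gammaPDF])]
  have h1 (x : ℝ) : (gammaPDF a r x).toReal • exp (-(s * x)) = (Ici 0).indicator
      (fun x => r ^ a / Gamma a * (x ^ (a - 1) * exp (-((r + s) * x)))) x := by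
    simp only [gammaPDF, smul_eq_mul]
    rw [ENNReal.toReal_ofReal (gammaPDFReal_nonneg ha hr x), gammaPDFReal]
    by_cases hx : 0 ≤ x
    · rw [if_pos hx, indicator_of_mem (by exact hx),
        show -((r + s) * x) = -(r * x) + -(s * x) by ring,
        Real.exp_add]
      ring
    · rw [if_neg hx, indicator_of_notMem (by exact hx), zero_mul]
  simp only [h1]
  rw [integral_indicator measurableSet_Ici, integral_Ici_eq_integral_Ioi, integral_const_mul,
    Real.integral_rpow_mul_exp_neg_mul_Ioi ha hrs, one_div, inv_rpow hrs.le]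
  field_simp

lemma integrable_exp_neg_mul_s15 {μ : Measure ℝ} [IsFiniteMeasure μ] (hμ : ∀ᵐ x ∂μ, 0 ≤ x)
    {y : ℝ} (hy : 0 ≤ y) : Integrable (fun x => exp (-(y * x))) μ := by
  refine Integrable.of_bound (C := 1) (by fun_prop) ?_
  filter_upwards [hμ] with x hx
  rw [Real.norm_eq_abs, abs_exp, exp_le_one_iff]
  linarith [mul_nonneg hy hx]

lemma lapl_pos_s15 {μ : Measure ℝ} [IsProbabilityMeasure μ] (hμ : ∀ᵐ x ∂μ, 0 ≤ x)
    {y : ℝ} (hy : 0 ≤ y) : 0 < lapl μ y :=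
  integral_exp_pos (integrable_exp_neg_mul_s15 hμ hy)

lemma lapl_anti {μ : Measure ℝ} [IsFiniteMeasure μ] (hμ : ∀ᵐ x ∂μ, 0 ≤ x)
    {y z : ℝ} (hy : 0 ≤ y) (hyz : y ≤ z) : lapl μ z ≤ lapl μ y := by
  refine integral_mono_ae (integrable_exp_neg_mul_s15 hμ (hy.trans hyz))
    (integrable_exp_neg_mul_s15 hμ hy) ?_
  filter_upwards [hμ] with x hx
  exact exp_le_exp.2 (neg_le_neg (mul_le_mul_of_nonneg_right hyz hx))

lemma lapl_map_Fumeas {F : Measure ℝ} {ψ : ℝ → ℝ} {u : ℝ} (hu : 0 < u) (c s : ℝ) :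
    lapl ((Fumeas F ψ u).map (fun x => c * x)) s = u⁻¹ * lapl F (ψ u + s * c) := by
  rw [lapl, integral_map (by fun_prop) (by fun_prop), Fumeas,
    integral_withDensity_eq_integral_toReal_smul (by fun_prop) (by simp), lapl,
    ← integral_const_mul]
  refine integral_congr_ae (Eventually.of_forall fun x => ?_)
  simp only [smul_eq_mul]
  rw [ENNReal.toReal_ofReal (by positivity), mul_assoc, ← Real.exp_add]
  ring_nf

lemma isProbabilityMeasure_Fumeas {F : Measure ℝ} [IsFiniteMeasure F] (hF : ∀ᵐ x ∂F, 0 ≤ x)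
    {ψ : ℝ → ℝ} {u : ℝ} (hu : 0 < u) (hψ : 0 ≤ ψ u) (h : lapl F (ψ u) = u) :
    IsProbabilityMeasure (Fumeas F ψ u) := by
  constructor
  rw [Fumeas, withDensity_apply _ MeasurableSet.univ, Measure.restrict_univ,
    ← ofReal_integral_eq_lintegral_ofReal ((integrable_exp_neg_mul_s15 hF hψ).const_mul _)
      (Eventually.of_forall fun x => by positivity), integral_const_mul]
  change ENNReal.ofReal (u⁻¹ * lapl F (ψ u)) = 1
  rw [h, inv_mul_cancel₀ hu.ne', ENNReal.ofReal_one]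

lemma tendsto_atTop_of_lapl_eq {F : Measure ℝ} [IsProbabilityMeasure F] (hF : ∀ᵐ x ∂F, 0 ≤ x)
    {ψ : ℝ → ℝ} (hψ : ∀ u ∈ Ioo (0:ℝ) 1, 0 < ψ u ∧ lapl F (ψ u) = u) :
    Tendsto ψ (𝓝[>] 0) atTop := by
  refine tendsto_atTop.2 fun M => ?_
  have hM := lapl_pos_s15 hF (le_max_right M 0)
  filter_upwards [Ioo_mem_nhdsGT one_pos, Ioo_mem_nhdsGT hM] with u hu huM
  by_contra! hlt
  have := lapl_anti hF (hψ u hu).1.le (hlt.le.trans (le_max_left M 0))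
  rw [(hψ u hu).2] at this
  exact this.not_gt huM.2

lemma tendsto_inv_mul_lapl {F : Measure ℝ} [IsProbabilityMeasure F] (hF : ∀ᵐ x ∂F, 0 ≤ x)
    {lam a : ℝ} (hlam : 0 < lam) (ha : 0 < a)
    {ψ : ℝ → ℝ} (hψ : ∀ u ∈ Ioo (0:ℝ) 1, 0 < ψ u ∧ lapl F (ψ u) = u)
    (hphi : lapl F ~[atTop] fun y => lam ^ a / y ^ a) {s : ℝ} (hs : 0 ≤ s) :
    Tendsto (fun u : ℝ => u⁻¹ * lapl F (ψ u + s * u ^ (-(1/a)))) (𝓝[>] 0)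
      (𝓝 (lam ^ a / (lam + s) ^ a)) := by
  have hlama : 0 < lam ^ a := rpow_pos_of_pos hlam a
  have hg : Tendsto (fun y => lapl F y * y ^ a) atTop (𝓝 (lam ^ a)) := by
    have hmul := hphi.mul (IsEquivalent.refl (u := fun y : ℝ => y ^ a) (l := atTop))
    have hconst : ((fun y => lam ^ a / y ^ a) * fun y => y ^ a) =ᶠ[atTop] fun _ => lam ^ a := by
      filter_upwards [eventually_gt_atTop 0] with y hy
      exact div_mul_cancel₀ _ (rpow_pos_of_pos hy a).ne'
    exact (isEquivalent_const_iff_tendsto hlama.ne').1 (hmul.congr_right hconst)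
  have hψtop := tendsto_atTop_of_lapl_eq hF hψ
  have hca {u : ℝ} (hu : 0 < u) : (u ^ (-(1/a))) ^ a = u⁻¹ := by
    rw [← rpow_mul hu.le, neg_mul, one_div_mul_cancel ha.ne', rpow_neg_one]
  have hratio : Tendsto (fun u => ψ u / u ^ (-(1/a))) (𝓝[>] 0) (𝓝 lam) := by
    have h := ((hg.comp hψtop).rpow_const (p := 1/a) (Or.inl hlama.ne'))
    rw [← rpow_mul hlam.le, mul_one_div_cancel ha.ne', rpow_one] at h
    refine h.congr' ?_
    filter_upwards [Ioo_mem_nhdsGT one_pos] with u hu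
    obtain ⟨hpos, heq⟩ := hψ u hu
    have hr : 0 ≤ ψ u / u ^ (-(1/a)) := div_nonneg hpos.le (rpow_nonneg hu.1.le _)
    have : lapl F (ψ u) * ψ u ^ a = (ψ u / u ^ (-(1/a))) ^ a := by
      rw [div_rpow hpos.le (rpow_nonneg hu.1.le _), hca hu.1, heq, div_inv_eq_mul, mul_comm]
    rw [Function.comp_apply, this, ← rpow_mul hr, mul_one_div_cancel ha.ne', rpow_one]
  have hytop : Tendsto (fun u => ψ u + s * u ^ (-(1/a))) (𝓝[>] 0) atTop := by
    refine tendsto_atTop_mono' _ ?_ hψtop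
    filter_upwards [self_mem_nhdsWithin] with u hu
    exact le_add_of_nonneg_right (mul_nonneg hs (rpow_nonneg (le_of_lt hu) _))
  have hden := (hratio.add_const s).rpow_const (p := a) (Or.inl (by positivity))
  refine ((hg.comp hytop).div hden (by positivity)).congr' ?_
  filter_upwards [Ioo_mem_nhdsGT one_pos] with u hu
  have hc : 0 < u ^ (-(1/a)) := rpow_pos_of_pos hu.1 _
  have hy : 0 < ψ u + s * u ^ (-(1/a)) := add_pos_of_pos_of_nonneg (hψ u hu).1 (by positivity)
  have : ψ u / u ^ (-(1/a)) + s = (ψ u + s * u ^ (-(1/a))) / u ^ (-(1/a)) := by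
    field_simp
  simp only [Pi.div_apply, Function.comp_apply]
  rw [this, div_rpow hy.le hc.le, hca hu.1]
  have hya := (rpow_pos_of_pos hy a).ne'
  have := hu.1.ne'
  field_simp

/-- If `φ(y) ∼ λᵃ/yᵃ` as `y → ∞` and `X'_u ~ F_u`, then `u^{-1/a} X'_u`
converges in distribution to `gamma(a,λ)` as `u → 0⁺` (convergence tested against bounded
continuous functions). -/
theorem Fu_rescaled_tendsto_gamma
    (F : Measure ℝ) [IsProbabilityMeasure F] (hsupp : F (Iic 0) = 0)
    (lam a : ℝ) (hlam : 0 < lam) (ha : 0 < a)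
    (ψ : ℝ → ℝ) (hψ : ∀ u ∈ Ioo (0:ℝ) 1, 0 < ψ u ∧ lapl F (ψ u) = u)
    (hphi : lapl F ~[atTop] fun y => lam ^ a / y ^ a) :
    ∀ f : BoundedContinuousFunction ℝ ℝ,
      Tendsto (fun u : ℝ => ∫ x, f (u ^ (-(1/a)) * x) ∂(Fumeas F ψ u)) (𝓝[>] (0:ℝ))
        (𝓝 (∫ x, f x ∂(gammaMeasure a lam))) := by
  intro f
  have hF : ∀ᵐ x ∂F, 0 ≤ x := by
    refine measure_mono_null (fun x hx => ?_) hsupp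
    exact le_of_lt (not_le.1 (show ¬ 0 ≤ x from hx))
  have := isProbabilityMeasure_gammaMeasure ha hlam
  have hmain := tendsto_integral_of_tendsto_lapl (l := 𝓝[>] (0:ℝ))
    (μ := fun u => (Fumeas F ψ u).map (fun x => u ^ (-(1/a)) * x))
    (ν := gammaMeasure a lam) ae_gammaMeasure_nonneg ?_ ?_ f
  · refine hmain.congr fun u => ?_
    exact integral_map (by fun_prop) f.continuous.aestronglyMeasurable
  · filter_upwards [Ioo_mem_nhdsGT one_pos] with u hu
    have := isProbabilityMeasure_Fumeas hF hu.1 (hψ u hu).1.le (hψ u hu).2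
    refine ⟨Measure.isProbabilityMeasure_map (by fun_prop), ?_⟩
    rw [ae_map_iff (by fun_prop) measurableSet_Ici]
    filter_upwards [(withDensity_absolutelyContinuous F _).ae_le hF] with x hx
    exact mul_nonneg (rpow_nonneg hu.1.le _) hx
  · intro n
    rw [lapl_gammaMeasure ha hlam n.cast_nonneg]
    refine (tendsto_inv_mul_lapl hF hlam ha hψ hphi n.cast_nonneg).congr' ?_
    filter_upwards [self_mem_nhdsWithin] with u hu
    exact (lapl_map_Fumeas hu _ _).symm
end
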